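/- Let n ≥ 1, let V be a real vector space of dimension 4n, and let Ω : V × V → ℂ be an ℝ-bilinear alternating complex-valued form satisfying Ω^(n+1) = 0 and Ω^n ∧ conj(Ω)^n ≠ 0. Write Ω = ω₁ + i·ω₂ with ω₁, ω₂ real-valued alternating bilinear forms on V, and regard ω₁, ω₂ as linear maps V → V* via contraction (v ↦ ω_j(v, ·)); the map ω₂ : V → V* is bijective. Then the endomorphism I = ω₂⁻¹ ∘ ω₁ of V satisfies I ∘ I = −id_V, i.e. I is a complex structure operator on V. -/

import Mathlib

open Module

/-- The wedge product `F 0 ∧ F 1 ∧ ⋯ ∧ F (m-1)` of a family of complex-valued 2-forms on `V`,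
as an (unnormalized) alternating `2m`-linear map: the signed sum over all permutations of the
products of the values of the `F i` on consecutive pairs of arguments. (This differs from the
usual wedge product only by the nonzero constant `2^m · m!`.) -/
noncomputable def wedgePow {V : Type*} (m : ℕ) (F : Fin m → V → V → ℂ)
    (v : Fin (2 * m) → V) : ℂ :=
  ∑ σ : Equiv.Perm (Fin (2 * m)), ((Equiv.Perm.sign σ : ℤ) : ℂ) *
    ∏ i : Fin m, F i (v (σ ⟨2 * (i : ℕ), by omega⟩)) (v (σ ⟨2 * (i : ℕ) + 1, by omega⟩))

section
variable {R V : Type*} [CommRing R] [Algebra R ℂ] [AddCommGroup V] [Module R V]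

/-- The product of 2-forms evaluated on consecutive pairs of arguments is linear in each
argument. -/
theorem exists_linear_prod_pairs_update {m : ℕ} (F : Fin m → V →ₗ[R] V →ₗ[R] ℂ)
    (v : Fin (2 * m) → V) (j : Fin (2 * m)) :
    ∃ L : V →ₗ[R] ℂ, ∀ x : V,
      ∏ i : Fin m, F i (Function.update v j x ⟨2 * (i : ℕ), by omega⟩)
        (Function.update v j x ⟨2 * (i : ℕ) + 1, by omega⟩) = L x := by
  have hk : (j : ℕ) / 2 < m := by omega
  set k : Fin m := ⟨(j : ℕ) / 2, hk⟩ with hkdef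
  set c : ℂ := ∏ i ∈ Finset.univ.erase k,
    F i (v ⟨2 * (i : ℕ), by omega⟩) (v ⟨2 * (i : ℕ) + 1, by omega⟩) with hc
  have hprod : ∀ x : V, ∏ i : Fin m, F i (Function.update v j x ⟨2 * (i : ℕ), by omega⟩)
        (Function.update v j x ⟨2 * (i : ℕ) + 1, by omega⟩) =
      F k (Function.update v j x ⟨2 * (k : ℕ), by omega⟩)
        (Function.update v j x ⟨2 * (k : ℕ) + 1, by omega⟩) * c := by
    intro x
    rw [← Finset.mul_prod_erase _ _ (Finset.mem_univ k), hc]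
    congr 1
    refine Finset.prod_congr rfl fun i hi => ?_
    have hik : (i : ℕ) ≠ (j : ℕ) / 2 := fun h => Finset.ne_of_mem_erase hi (Fin.ext h)
    rw [Function.update_of_ne, Function.update_of_ne] <;>
      · rw [Ne, Fin.ext_iff]; dsimp only; omega
  rcases Nat.even_or_odd' (j : ℕ) with ⟨r, hr | hr⟩
  · refine ⟨LinearMap.mulRight R c ∘ₗ (F k).flip (v ⟨2 * (k : ℕ) + 1, by omega⟩), fun x => ?_⟩
    have hj : (⟨2 * (k : ℕ), by omega⟩ : Fin (2 * m)) = j := by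
      rw [Fin.ext_iff]; simp only [hkdef]; omega
    rw [hprod, hj, Function.update_self, Function.update_of_ne]
    · simp
    · rw [Ne, Fin.ext_iff]; simp only [hkdef]; omega
  · refine ⟨LinearMap.mulRight R c ∘ₗ F k (v ⟨2 * (k : ℕ), by omega⟩), fun x => ?_⟩
    have hj : (⟨2 * (k : ℕ) + 1, by omega⟩ : Fin (2 * m)) = j := by
      rw [Fin.ext_iff]; simp only [hkdef]; omega
    rw [hprod, hj, Function.update_self, Function.update_of_ne]
    · simp
    · rw [Ne, Fin.ext_iff]; simp only [hkdef]; omega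

/-- The tensor product of a family of 2-forms, evaluated on consecutive pairs of arguments. -/
def pairProd {m : ℕ} (F : Fin m → V →ₗ[R] V →ₗ[R] ℂ) :
    MultilinearMap R (fun _ : Fin (2 * m) => V) ℂ :=
  MultilinearMap.mk'
    (fun v => ∏ i : Fin m, F i (v ⟨2 * (i : ℕ), by omega⟩) (v ⟨2 * (i : ℕ) + 1, by omega⟩))
    (fun v j x y => by
      obtain ⟨L, hL⟩ := exists_linear_prod_pairs_update F v j
      rw [hL, hL, hL, map_add])
    (fun v j c x => by
      obtain ⟨L, hL⟩ := exists_linear_prod_pairs_update F v j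
      rw [hL, hL, map_smul])

theorem wedgePow_eq_alternatization {m : ℕ} (F : Fin m → V →ₗ[R] V →ₗ[R] ℂ)
    (v : Fin (2 * m) → V) :
    wedgePow m (fun i x y => F i x y) v = MultilinearMap.alternatization (pairProd F) v := by
  rw [MultilinearMap.alternatization_apply, wedgePow]
  refine Finset.sum_congr rfl fun σ _ => ?_
  rw [Units.smul_def, zsmul_eq_mul]
  rfl

end

/-- A complex-valued wedge product of top degree vanishes if its factors have a common nonzero
kernel vector. -/
theorem wedgePow_eq_zero_of_common_kernel {K V : Type*} [Field K] [Algebra K ℂ] [AddCommGroup V]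
    [Module K V] [FiniteDimensional K V] {m : ℕ} (hdim : finrank K V = 2 * m)
    (F : Fin m → V →ₗ[K] V →ₗ[K] ℂ) {a : V} (ha : a ≠ 0)
    (hl : ∀ i u, F i a u = 0) (hr : ∀ i u, F i u a = 0) :
    wedgePow m (fun i x y => F i x y) = 0 := by
  have hli : LinearIndepOn K id ({a} : Set V) := LinearIndepOn.singleton ha
  let b := Basis.extend hli
  have hab : a ∈ hli.extend (Set.subset_univ _) := hli.subset_extend _ rfl
  have : Fintype (hli.extend (Set.subset_univ _)) := FiniteDimensional.fintypeBasisIndex b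
  have hcard : Fintype.card (Fin (2 * m)) = Fintype.card (hli.extend (Set.subset_univ _)) := by
    rw [Fintype.card_fin, ← hdim, finrank_eq_card_basis b]
  have h0 : MultilinearMap.alternatization (pairProd F) = 0 := by
    refine b.ext_alternating fun w hw => ?_
    obtain ⟨j, hj⟩ := ((Fintype.bijective_iff_injective_and_card w).2 ⟨hw, hcard⟩).2 ⟨a, hab⟩
    have hbj : b (w j) = a := by rw [hj]; exact Basis.extend_apply_self hli _
    rw [← wedgePow_eq_alternatization, AlternatingMap.zero_apply, wedgePow]
    refine Finset.sum_eq_zero fun σ _ => ?_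
    have hlt := (σ.symm j).isLt
    rw [Finset.prod_eq_zero (Finset.mem_univ ⟨(σ.symm j : ℕ) / 2, by omega⟩), mul_zero]
    rcases Nat.even_or_odd' (σ.symm j : ℕ) with ⟨r, hr' | hr'⟩
    · have : (⟨2 * ((σ.symm j : ℕ) / 2), by omega⟩ : Fin (2 * m)) = σ.symm j := by
        rw [Fin.ext_iff]; dsimp only; omega
      simp only [this, Equiv.apply_symm_apply, hbj, hl]
    · have : (⟨2 * ((σ.symm j : ℕ) / 2) + 1, by omega⟩ : Fin (2 * m)) = σ.symm j := by
        rw [Fin.ext_iff]; dsimp only; omega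
      simp only [this, Equiv.apply_symm_apply, hbj, hr]
  funext v
  rw [wedgePow_eq_alternatization, h0]
  rfl

/-- The signed sum computing the `m`-th power of the standard symplectic form on a symplectic basis
is nonzero: each of its terms is `0` or `1`. -/
theorem sum_perm_pairs {m : ℕ} {s : Fin 2 → Fin 2 → ℂ} (h01 : s 0 1 = 1) (h10 : s 1 0 = -1) :
    ∑ τ : Equiv.Perm (Fin m × Fin 2), ((Equiv.Perm.sign τ : ℤ) : ℂ) *
      ∏ i : Fin m, (if (τ (i, 0)).1 = (τ (i, 1)).1 then s (τ (i, 0)).2 (τ (i, 1)).2 else 0)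
        ≠ 0 := by
  set T : Equiv.Perm (Fin m × Fin 2) → ℂ := fun τ => ((Equiv.Perm.sign τ : ℤ) : ℂ) *
      ∏ i : Fin m, (if (τ (i, 0)).1 = (τ (i, 1)).1 then s (τ (i, 0)).2 (τ (i, 1)).2 else 0)
    with hT
  have hs : ∀ ε : Equiv.Perm (Fin 2), s (ε 0) (ε 1) = ((Equiv.Perm.sign ε : ℤ) : ℂ) := by
    intro ε
    have : ε = 1 ∨ ε = Equiv.swap 0 1 := by revert ε; decide
    rcases this with rfl | rfl
    · simp [h01]
    · simp [h10]
  have h1 : ∀ τ, T τ ≠ 0 → T τ = 1 := by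
    intro τ hτ
    have hpair : ∀ i, (τ (i, 0)).1 = (τ (i, 1)).1 := by
      intro i
      by_contra hne
      exact hτ (mul_eq_zero_of_right _ (Finset.prod_eq_zero (Finset.mem_univ i) (if_neg hne)))
    have hfst : ∀ i a, (τ (i, a)).1 = (τ (i, 0)).1 := by
      intro i a
      fin_cases a
      · rfl
      · exact (hpair i).symm
    have hsurj : Function.Surjective fun i => (τ (i, 0)).1 := by
      intro k
      obtain ⟨⟨i, a⟩, hi⟩ := τ.surjective (k, 0)
      exact ⟨i, by simp only [← hfst i a, hi]⟩
    let π : Equiv.Perm (Fin m) := Equiv.ofBijective _ (Finite.surjective_iff_bijective.1 hsurj)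
    have hinj : ∀ i, Function.Injective fun a => (τ (i, a)).2 := by
      intro i a b hab
      have : τ (i, a) = τ (i, b) := Prod.ext ((hfst i a).trans (hfst i b).symm) hab
      simpa using τ.injective this
    let ε : Fin m → Equiv.Perm (Fin 2) := fun i =>
      Equiv.ofBijective _ (Finite.injective_iff_bijective.1 (hinj i))
    have hdecomp : τ = Equiv.prodCongrLeft (fun _ : Fin 2 => π) * Equiv.prodCongrRight ε := by
      ext1 ⟨i, a⟩
      exact Prod.ext (hfst i a) rfl
    have hsign : ((Equiv.Perm.sign τ : ℤ) : ℂ) = ∏ i, ((Equiv.Perm.sign (ε i) : ℤ) : ℂ) := by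
      rw [hdecomp, Equiv.Perm.sign_mul, Equiv.Perm.sign_prodCongrLeft,
        Equiv.Perm.sign_prodCongrRight]
      simp
    have hprod : ∏ i : Fin m, (if (τ (i, 0)).1 = (τ (i, 1)).1
        then s (τ (i, 0)).2 (τ (i, 1)).2 else 0) = ∏ i, ((Equiv.Perm.sign (ε i) : ℤ) : ℂ) := by
      refine Finset.prod_congr rfl fun i _ => ?_
      rw [if_pos (hpair i), ← hs (ε i)]
      rfl
    simp only [hT]
    rw [hprod, hsign, ← Finset.prod_mul_distrib]
    refine Finset.prod_eq_one fun i _ => ?_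
    rcases Int.units_eq_one_or (Equiv.Perm.sign (ε i)) with h | h <;> simp [h]
  have hone : T 1 ≠ 0 := by simp [hT, h01]
  have hsum : ∑ τ, T τ = ((Finset.univ.filter fun τ => T τ ≠ 0).card : ℂ) := by
    rw [← Finset.sum_filter_ne_zero,
      Finset.sum_congr rfl fun τ hτ => h1 τ (Finset.mem_filter.1 hτ).2]
    simp
  rw [hsum, Nat.cast_ne_zero]
  exact Finset.card_ne_zero_of_mem (Finset.mem_filter.2 ⟨Finset.mem_univ 1, hone⟩)

/-- The `m`-th power of a 2-form does not vanish on a symplectic family of `m` pairs. -/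
theorem wedgePow_ne_zero_of_symplectic {V : Type*} {m : ℕ} (B : V → V → ℂ) (x y : Fin m → V)
    (hxx : ∀ i j, B (x i) (x j) = 0) (hyy : ∀ i j, B (y i) (y j) = 0)
    (hxy : ∀ i j, B (x i) (y j) = if i = j then 1 else 0)
    (hyx : ∀ i j, B (y i) (x j) = if i = j then -1 else 0) :
    wedgePow m (fun _ => B) ≠ 0 := by
  let e : Fin m × Fin 2 ≃ Fin (2 * m) := finProdFinEquiv.trans (finCongr (mul_comm m 2))
  let u : Fin m × Fin 2 → V := fun p => ![x p.1, y p.1] p.2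
  let s : Fin 2 → Fin 2 → ℂ := ![![0, 1], ![-1, 0]]
  have hu : ∀ p q, B (u p) (u q) = if p.1 = q.1 then s p.2 q.2 else 0 := by
    rintro ⟨i, a⟩ ⟨j, b⟩
    fin_cases a <;> fin_cases b <;> simp [u, s, hxx, hyy, hxy, hyx]
  intro h0
  have h := congrFun h0 (u ∘ e.symm)
  refine sum_perm_pairs (m := m) (s := s) rfl rfl ?_
  refine Eq.trans ?_ h
  rw [wedgePow, ← Equiv.sum_comp e.permCongr]
  refine Finset.sum_congr rfl fun τ _ => ?_
  rw [Equiv.Perm.sign_permCongr]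
  congr 1
  refine Finset.prod_congr rfl fun i _ => ?_
  have h0 : (⟨2 * (i : ℕ), by omega⟩ : Fin (2 * m)) = e (i, 0) := by
    rw [Fin.ext_iff]; simp [e]
  have h1 : (⟨2 * (i : ℕ) + 1, by omega⟩ : Fin (2 * m)) = e (i, 1) := by
    rw [Fin.ext_iff]; simp [e, add_comm]
  rw [h0, h1, ← hu]
  simp [Equiv.permCongr_apply]

/-- An alternating form of rank at least `2m - 1` (hence at least `2m`) admits a symplectic family
of `m` pairs. -/
theorem exists_symplectic_family {K W : Type*} [Field K] [AddCommGroup W] [Module K W]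
    [FiniteDimensional K W] (B : W →ₗ[K] W →ₗ[K] K) (hB : B.IsAlt) (m : ℕ)
    (hm : finrank K (LinearMap.ker B) + 2 * m < finrank K W + 2) :
    ∃ x y : Fin m → W, (∀ i j, B (x i) (x j) = 0) ∧ (∀ i j, B (y i) (y j) = 0) ∧
      ∀ i j, B (x i) (y j) = if i = j then 1 else 0 := by
  induction m with
  | zero => exact ⟨Fin.elim0, Fin.elim0, fun i => i.elim0, fun i => i.elim0, fun i => i.elim0⟩
  | succ m ih =>
    obtain ⟨x, y, hxx, hyy, hxy⟩ := ih (by omega)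
    have hyx : ∀ i j, B (y i) (x j) = if j = i then -1 else 0 := by
      intro i j
      rw [← hB.neg, hxy]
      split_ifs <;> simp
    set P : Submodule K W := LinearMap.ker (LinearMap.pi fun i => B (x i)) ⊓
      LinearMap.ker (LinearMap.pi fun i => B (y i)) with hP
    have hmem : ∀ w, w ∈ P ↔ (∀ i, B (x i) w = 0) ∧ ∀ i, B (y i) w = 0 := by
      intro w
      simp [hP, funext_iff]
    have hPdim : finrank K W ≤ finrank K P + 2 * m := by
      have h1 := (LinearMap.pi fun i => B (x i)).finrank_range_add_finrank_ker
      have h2 := (LinearMap.pi fun i => B (y i)).finrank_range_add_finrank_ker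
      have h3 := Submodule.finrank_le (LinearMap.range (LinearMap.pi fun i => B (x i)))
      have h4 := Submodule.finrank_le (LinearMap.range (LinearMap.pi fun i => B (y i)))
      have h5 := Submodule.finrank_sup_add_finrank_inf_eq
        (LinearMap.ker (LinearMap.pi fun i => B (x i)))
        (LinearMap.ker (LinearMap.pi fun i => B (y i)))
      have h6 := Submodule.finrank_le (LinearMap.ker (LinearMap.pi fun i => B (x i)) ⊔
        LinearMap.ker (LinearMap.pi fun i => B (y i)))
      rw [finrank_fin_fun] at h3 h4
      rw [← hP] at h5
      omega
    obtain ⟨a, ha, b, hb, hab⟩ : ∃ a ∈ P, ∃ b ∈ P, B a b ≠ 0 := by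
      by_contra! hzero
      have hle : P ≤ LinearMap.ker B := by
        intro a ha
        have hax : ∀ i, B a (x i) = 0 := fun i => by rw [← hB.neg, ((hmem a).1 ha).1, neg_zero]
        have hay : ∀ i, B a (y i) = 0 := fun i => by rw [← hB.neg, ((hmem a).1 ha).2, neg_zero]
        refine LinearMap.mem_ker.2 (LinearMap.ext fun w => ?_)
        have hw : w + ∑ i, (B (y i) w • x i - B (x i) w • y i) ∈ P := by
          refine (hmem _).2 ⟨fun j => ?_, fun j => ?_⟩
          · simp [hxx, hxy]
          · simp [hyy, hyx]
        simpa [hax, hay] using hzero a ha _ hw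
      have := Submodule.finrank_mono hle
      omega
    obtain ⟨hax, hay⟩ := (hmem a).1 ha
    obtain ⟨hbx, hby⟩ := (hmem b).1 hb
    have hxa : ∀ i, B a (x i) = 0 := fun i => by rw [← hB.neg, hax, neg_zero]
    have hya : ∀ i, B a (y i) = 0 := fun i => by rw [← hB.neg, hay, neg_zero]
    have hyb : ∀ i, B b (y i) = 0 := fun i => by rw [← hB.neg, hby, neg_zero]
    refine ⟨Fin.cons a x, Fin.cons ((B a b)⁻¹ • b) y, ?_, ?_, ?_⟩
    · intro i j
      refine Fin.cases ?_ (fun i => ?_) i <;> refine Fin.cases ?_ (fun j => ?_) j <;>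
        simp [hB.self_eq_zero, hxx, hax, hxa]
    · intro i j
      refine Fin.cases ?_ (fun i => ?_) i <;> refine Fin.cases ?_ (fun j => ?_) j <;>
        simp [hB.self_eq_zero, hyy, hby, hyb]
    · intro i j
      refine Fin.cases ?_ (fun i => ?_) i <;> refine Fin.cases ?_ (fun j => ?_) j <;>
        simp [hab, hxy, hbx, hya, (Fin.succ_ne_zero _).symm]

/-- If `Ω ^ (n + 1) = 0` then the complexified form has a kernel of complex codimension at most
`2 n`; if in addition no nonzero real vector lies in the kernel of `Ω` and `dim V = 4 n`, then every
real vector is the real part of a kernel vector. -/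
theorem exists_imaginary_part_mem_kernel {V : Type*} [AddCommGroup V] [Module ℝ V]
    [FiniteDimensional ℝ V] {n : ℕ} (hdim : finrank ℝ V = 4 * n) (Ω : V →ₗ[ℝ] V →ₗ[ℝ] ℂ)
    (halt : ∀ v : V, Ω v v = 0) (hpow : wedgePow (n + 1) (fun _ u v => Ω u v) = 0)
    (hker : ∀ v, Ω v = 0 → v = 0) (v : V) :
    ∃ w : V, ∀ u, Ω v u + Complex.I * Ω w u = 0 := by
  let b := finBasis ℝ V
  let M : Matrix (Fin (finrank ℝ V)) (Fin (finrank ℝ V)) ℂ := Matrix.of fun i j => Ω (b i) (b j)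
  let B : (Fin (finrank ℝ V) → ℂ) →ₗ[ℂ] (Fin (finrank ℝ V) → ℂ) →ₗ[ℂ] ℂ :=
    Matrix.toLinearMap₂' ℂ M
  have hneg : ∀ u v, Ω u v = -Ω v u := fun u v => (LinearMap.IsAlt.neg halt v u).symm
  have hBapply : ∀ z w, B z w = ∑ i, ∑ j, z i * w j * M i j := by
    intro z w
    simp only [B, Matrix.toLinearMap₂'_apply, smul_eq_mul]
    exact Finset.sum_congr rfl fun i _ => Finset.sum_congr rfl fun j _ => by ring
  have hBsingle : ∀ i j, B (Pi.single i 1) (Pi.single j 1) = M i j := fun i j => by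
    simp [hBapply, Pi.single_apply]
  have hB : B.IsAlt := by
    intro z
    have h : B z z = -B z z := by
      conv_lhs => rw [hBapply, Finset.sum_comm]
      rw [hBapply, ← Finset.sum_neg_distrib]
      refine Finset.sum_congr rfl fun i _ => ?_
      rw [← Finset.sum_neg_distrib]
      refine Finset.sum_congr rfl fun j _ => ?_
      simp only [M, Matrix.of_apply]
      rw [hneg (b j)]
      ring
    exact self_eq_neg.1 h
  have hBpow : wedgePow (n + 1) (fun _ z w => B z w) = 0 := by
    have h0 : MultilinearMap.alternatization (pairProd fun _ : Fin (n + 1) => B) = 0 := by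
      refine (Pi.basisFun ℂ (Fin (finrank ℝ V))).ext_alternating fun k _ => ?_
      have h := congrFun hpow fun i => b (k i)
      rw [← wedgePow_eq_alternatization, AlternatingMap.zero_apply]
      refine Eq.trans ?_ h
      simp only [wedgePow, Pi.basisFun_apply, hBsingle, M, Matrix.of_apply]
    funext z
    refine (wedgePow_eq_alternatization (fun _ => B) z).trans ?_
    rw [h0]
    rfl
  have hrank : 4 * n ≤ finrank ℂ (LinearMap.ker B) + 2 * n := by
    by_contra! hlt
    obtain ⟨x, y, hxx, hyy, hxy⟩ := exists_symplectic_family B hB (n + 1) (by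
      rw [finrank_fin_fun]; omega)
    refine wedgePow_ne_zero_of_symplectic (fun z w => B z w) x y hxx hyy hxy (fun i j => ?_) hBpow
    rw [← hB.neg, hxy]
    by_cases hij : i = j
    · simp [hij]
    · simp [hij, Ne.symm hij]
  let re : (Fin (finrank ℝ V) → ℂ) →ₗ[ℝ] V :=
    b.equivFun.symm.toLinearMap ∘ₗ Complex.reLm.compLeft _
  let im : (Fin (finrank ℝ V) → ℂ) →ₗ[ℝ] V :=
    b.equivFun.symm.toLinearMap ∘ₗ Complex.imLm.compLeft _
  have hre_apply : ∀ z, re z = ∑ i, (z i).re • b i := fun z => by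
    simp [re, Basis.equivFun_symm_apply]
  have him_apply : ∀ z, im z = ∑ i, (z i).im • b i := fun z => by
    simp [im, Basis.equivFun_symm_apply]
  have hmem : ∀ z ∈ LinearMap.ker B, ∀ u, Ω (re z) u + Complex.I * Ω (im z) u = 0 := by
    intro z hz u
    have hlin : Ω (re z) + LinearMap.mulLeft ℝ Complex.I ∘ₗ Ω (im z) = 0 := by
      refine b.ext fun j => ?_
      have h := LinearMap.congr_fun (LinearMap.mem_ker.1 hz) (Pi.single j 1)
      rw [hBapply] at h
      simp only [Pi.single_apply, mul_ite, mul_one, mul_zero, ite_mul, zero_mul,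
        Finset.sum_ite_eq', Finset.mem_univ, if_true, LinearMap.zero_apply] at h
      rw [LinearMap.zero_apply, ← h]
      simp only [hre_apply, him_apply, map_sum, map_smul, LinearMap.add_apply, LinearMap.comp_apply,
        LinearMap.sum_apply, LinearMap.smul_apply, LinearMap.mulLeft_apply,
        ← Finset.sum_add_distrib]
      refine Finset.sum_congr rfl fun i _ => ?_
      conv_rhs => rw [← Complex.re_add_im (z i)]
      simp only [Complex.real_smul, M, Matrix.of_apply]
      ring
    simpa using LinearMap.congr_fun hlin u
  let reK : (LinearMap.ker B).restrictScalars ℝ →ₗ[ℝ] V := re.domRestrict _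
  have hinj : Function.Injective reK := by
    rw [injective_iff_map_eq_zero]
    rintro ⟨z, hz⟩ hz0
    have hre : re z = 0 := hz0
    have him : im z = 0 := hker _ <| LinearMap.ext fun u => by
      simpa [hre] using hmem z hz u
    have hre' : ∀ i, (z i).re = 0 := fun i => by
      have := (LinearEquiv.map_eq_zero_iff b.equivFun.symm).1 hre
      exact congrFun this i
    have him' : ∀ i, (z i).im = 0 := fun i => by
      have := (LinearEquiv.map_eq_zero_iff b.equivFun.symm).1 him
      exact congrFun this i
    exact Subtype.ext (funext fun i => Complex.ext (hre' i) (him' i))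
  have hsurj : Function.Surjective reK := by
    have hfin : finrank ℝ ((LinearMap.ker B).restrictScalars ℝ) =
        2 * finrank ℂ (LinearMap.ker B) := finrank_real_of_complex (LinearMap.ker B)
    have hle := LinearMap.finrank_le_finrank_of_injective hinj
    exact (LinearMap.injective_iff_surjective_of_finrank_eq_finrank (by omega)).1 hinj
  obtain ⟨⟨z, hz⟩, rfl⟩ := hsurj v
  exact ⟨im z, hmem z hz⟩

/-- Let `V` be a real vector space of dimension `4n` and `Ω` an ℝ-bilinear alternating
complex-valued form on `V` with `Ω^(n+1) = 0` and `Ω^n ∧ conj(Ω)^n ≠ 0` (C-symplectic).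
Write `Ω = ω₁ + i·ω₂` and regard `ω₁, ω₂ : V → V*` via contraction. Then `ω₂ : V → V*`
is bijective, and the endomorphism `I = ω₂⁻¹ ∘ ω₁` of `V` (i.e. the unique `I` with
`ω₂ ∘ I = ω₁`) satisfies `I ∘ I = −id_V`, i.e. `I` is a complex structure operator. -/
theorem stmt9 (n : ℕ) (hn : 1 ≤ n) (V : Type*) [AddCommGroup V] [Module ℝ V]
    [FiniteDimensional ℝ V] (hdim : finrank ℝ V = 4 * n)
    (Ω : V →ₗ[ℝ] V →ₗ[ℝ] ℂ) (halt : ∀ v : V, Ω v v = 0)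
    (hpow : wedgePow (n + 1) (fun _ u v => Ω u v) = 0)
    (hnz : wedgePow (2 * n)
      (fun i u v => if (i : ℕ) < n then Ω u v else (starRingEnd ℂ) (Ω u v)) ≠ 0)
    (ω₁ ω₂ : V →ₗ[ℝ] V →ₗ[ℝ] ℝ)
    (hdec : ∀ u v : V, Ω u v = (ω₁ u v : ℂ) + Complex.I * (ω₂ u v : ℂ)) :
    Function.Bijective ω₂ ∧
      ∀ I : V →ₗ[ℝ] V, (∀ v : V, ω₂ (I v) = ω₁ v) →
        I ∘ₗ I = -LinearMap.id := by
  have hker : ∀ v, Ω v = 0 → v = 0 := by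
    intro v hv
    by_contra hv0
    have hr : ∀ u, Ω u v = 0 := fun u => by
      rw [← LinearMap.IsAlt.neg halt v u, hv, LinearMap.zero_apply, neg_zero]
    refine hnz ?_
    have h := wedgePow_eq_zero_of_common_kernel (K := ℝ) (m := 2 * n) (by omega)
      (fun i => if (i : ℕ) < n then Ω else Ω.compr₂ Complex.conjAe.toLinearMap) hv0
      (fun i u => by split_ifs <;> simp [hv]) (fun i u => by split_ifs <;> simp [hr])
    refine Eq.trans ?_ h
    congr 1
    funext i u w
    split_ifs <;> simp
  have hpair : ∀ v, ∃ w, (∀ u, ω₂ w u = ω₁ v u) ∧ ∀ u, ω₁ w u = -ω₂ v u := by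
    intro v
    obtain ⟨w, hw⟩ := exists_imaginary_part_mem_kernel hdim Ω halt hpow hker v
    refine ⟨w, fun u => ?_, fun u => ?_⟩
    · have := congrArg Complex.re (hw u)
      simp [hdec] at this
      linarith
    · have := congrArg Complex.im (hw u)
      simp [hdec] at this
      linarith
  have halt₁ : ω₁.IsAlt := fun v => by simpa [hdec] using congrArg Complex.re (halt v)
  have halt₂ : ω₂.IsAlt := fun v => by simpa [hdec] using congrArg Complex.im (halt v)
  have hinj : Function.Injective ω₂ := by
    rw [injective_iff_map_eq_zero]
    intro v hv
    refine hker v (LinearMap.ext fun u => ?_)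
    obtain ⟨w, hw, -⟩ := hpair u
    have h₁ : ω₁ v u = 0 := by
      rw [← halt₁.neg, ← hw, ← halt₂.neg, hv]
      simp
    simp [hdec, h₁, hv]
  refine ⟨⟨hinj, (LinearMap.injective_iff_surjective_of_finrank_eq_finrank
    Subspace.dual_finrank_eq.symm).1 hinj⟩, fun I hI => LinearMap.ext fun v => hinj ?_⟩
  obtain ⟨w, hw₂, hw₁⟩ := hpair v
  have hIv : I v = w := hinj (LinearMap.ext fun u => by rw [hI, hw₂])
  refine LinearMap.ext fun u => ?_
  simp [hI, hIv, hw₁]
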